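/- Let X be a compact Polish space with metrization ρ, M ⊆ P(X) convex and nonempty, r₀ > 0, and U := {μ ∈ P(X) : D^ρ(μ,M) > r₀}. Then there exists a map β' : U → Lip(X,ρ), continuous with respect to the norm ‖·‖_ρ on Lipschitz functions, such that for every μ ∈ U, writing r_μ := D^ρ(μ,M): ‖β'(μ)‖_ρ < r_μ − r₀ and inf_{ν∈M} E_ν[β'(μ)] − E_μ[β'(μ)] > ½(r_μ − r₀)·r_μ. -/

import Mathlib

open MeasureTheory Filter Set Topology
open scoped NNReal ENNReal

noncomputable section

/-- The completion of the ambient σ-algebra with respect to a measure `μ`: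
the σ-algebra of `μ`-null-measurable sets. -/
def completionMS {Y : Type*} [MeasurableSpace Y] (μ : Measure Y) : MeasurableSpace Y where
  MeasurableSet' s := NullMeasurableSet s μ
  measurableSet_empty := MeasurableSet.empty.nullMeasurableSet
  measurableSet_compl := fun _ h => h.compl
  measurableSet_iUnion := fun _ h => NullMeasurableSet.iUnion h

/-- The σ-algebra of universally measurable sets: the intersection of the completions
of the ambient (Borel) σ-algebra with respect to all probability measures. -/
def univMS (Y : Type*) [MeasurableSpace Y] : MeasurableSpace Y :=
  ⨅ (μ : Measure Y) (_ : IsProbabilityMeasure μ), completionMS μ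

/-- The support of a probability measure: the set of points all of whose open
neighbourhoods have positive measure. -/
def msupp {X : Type*} [TopologicalSpace X] [MeasurableSpace X] (μ : ProbabilityMeasure X) :
    Set X :=
  {x | ∀ U : Set X, IsOpen U → x ∈ U → 0 < μ.toMeasure U}

/-- `ρ` is a metrization of the topological space `X`: it is a metric and the
neighbourhood filters are generated by its open balls. -/
structure IsMetrization {X : Type*} [TopologicalSpace X] (ρ : X → X → ℝ) : Prop where
  refl : ∀ x, ρ x x = 0
  pos : ∀ x y, x ≠ y → 0 < ρ x y
  symm : ∀ x y, ρ x y = ρ y x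
  triangle : ∀ x y z, ρ x z ≤ ρ x y + ρ y z
  nhds_basis : ∀ x : X, (nhds x).HasBasis (fun ε : ℝ => 0 < ε) (fun ε => {y | ρ x y < ε})

/-- `f` is Lipschitz with respect to the metric `ρ`. -/
def LipWrt {X : Type*} (ρ : X → X → ℝ) (f : X → ℝ) : Prop :=
  ∃ K : ℝ, ∀ x y, |f x - f y| ≤ K * ρ x y

/-- The norm `‖f‖_ρ := max_x |f x| + sup_{x ≠ y} |f x - f y| / ρ x y` on Lipschitz functions. -/
def lipNorm {X : Type*} (ρ : X → X → ℝ) (f : X → ℝ) : ℝ :=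
  (⨆ x, |f x|) + sSup {c | ∃ x y, x ≠ y ∧ c = |f x - f y| / ρ x y}

/-- The Kantorovich-Rubinstein distance
`D^ρ(μ, ν) := sup {E_μ[f] - E_ν[f] | f Lipschitz, ‖f‖_ρ ≤ 1}`. -/
def KRdist {X : Type*} [MeasurableSpace X] (ρ : X → X → ℝ) (μ ν : ProbabilityMeasure X) : ℝ :=
  sSup {c | ∃ f : X → ℝ, LipWrt ρ f ∧ lipNorm ρ f ≤ 1 ∧
    c = (∫ x, f x ∂(μ : Measure X)) - ∫ x, f x ∂(ν : Measure X)}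

/-- The Kantorovich-Rubinstein distance from a measure to a set of measures. -/
def KRdistSet {X : Type*} [MeasurableSpace X] (ρ : X → X → ℝ) (μ : ProbabilityMeasure X)
    (A : Set (ProbabilityMeasure X)) : ℝ :=
  sInf {c | ∃ ν ∈ A, c = KRdist ρ μ ν}

/-- Convexity for a set of probability measures. -/
def ConvexPM {X : Type*} [MeasurableSpace X] (A : Set (ProbabilityMeasure X)) : Prop :=
  ∀ μ ∈ A, ∀ ν ∈ A, ∀ p : ℝ≥0, p ≤ 1 → ∀ ξ : ProbabilityMeasure X,
    (ξ : Measure X) = p • (μ : Measure X) + (1 - p) • (ν : Measure X) → ξ ∈ A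

/-- `κ` is a regular conditional probability for `μ` given `π`: it is a measurable family
of probability measures which disintegrates `μ` over `π_* μ` and is concentrated on fibers. -/
def IsRCP {X Y : Type*} [MeasurableSpace X] [MeasurableSpace Y]
    (μ : Measure X) (π : X → Y) (κ : Y → ProbabilityMeasure X) : Prop :=
  Measurable (fun y => (κ y : Measure X)) ∧
  (∀ s : Set X, MeasurableSet s → ∀ t : Set Y, MeasurableSet t →
    μ (s ∩ π ⁻¹' t) = ∫⁻ y in t, (κ y : Measure X) s ∂(μ.map π)) ∧
  (∀ᵐ y ∂(μ.map π), (κ y : Measure X) (π ⁻¹' {y}) = 1)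

/-- `N` is a regular upper bound for `M | π` (Definition 2.2 of the paper). -/
structure IsRUB {X Y : Type*} [TopologicalSpace X] [TopologicalSpace Y]
    [MeasurableSpace X] [MeasurableSpace Y] [OpensMeasurableSpace X]
    (π : X → Y) (M : Set (ProbabilityMeasure X)) (N : Y → Set (ProbabilityMeasure X)) : Prop where
  closed : IsClosed {p : Y × ProbabilityMeasure X | p.2 ∈ N p.1}
  convex : ∀ y, ConvexPM (N y)
  cond : ∀ μ ∈ M, ∀ κ : Y → ProbabilityMeasure X, IsRCP (μ : Measure X) π κ →
    ∀ᵐ y ∂((μ : Measure X).map π), κ y ∈ N y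

/-- `β` is an `(M, r₀)`-savvy bet (with respect to the metric `ρ`). -/
def IsSavvy {X : Type*} [TopologicalSpace X] [MeasurableSpace X] [OpensMeasurableSpace X]
    (ρ : X → X → ℝ) (M : Set (ProbabilityMeasure X)) (r₀ : ℝ)
    (β : ProbabilityMeasure X × X → ℝ) : Prop :=
  Continuous β ∧
  ∀ μ : ProbabilityMeasure X,
    (∀ x, |β (μ, x)| ≤ max (KRdistSet ρ μ M - r₀) 0) ∧
    ∀ ν ∈ M, (1/2) * (KRdistSet ρ μ M - r₀) * KRdistSet ρ μ M ≤
      (∫ x, β (μ, x) ∂(ν : Measure X)) - ∫ x, β (μ, x) ∂(μ : Measure X)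

/-- Borel σ-algebra on the space of probability measures (with its weak topology). -/
instance {X : Type*} [TopologicalSpace X] [MeasurableSpace X] [OpensMeasurableSpace X] :
    MeasurableSpace (ProbabilityMeasure X) := borel _

/-- Borel σ-algebra on a space of continuous functions. -/
instance {Y : Type*} [TopologicalSpace Y] : MeasurableSpace C(Y, ℝ) := borel _

end

section LipNorm

variable {X : Type*} [MetricSpace X] [CompactSpace X]

omit [CompactSpace X] in
lemma LipWrt.continuous {f : X → ℝ} (hf : LipWrt dist f) : Continuous f := by
  obtain ⟨K, hK⟩ := hf
  refine (LipschitzWith.of_dist_le_mul (K := K.toNNReal) fun x y => ?_).continuous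
  rw [Real.dist_eq]
  exact (hK x y).trans (mul_le_mul_of_nonneg_right (Real.le_coe_toNNReal K) dist_nonneg)

/-- A division-free description of the closed balls for the Lipschitz norm. -/
lemma lipNorm_le_iff [Nonempty X] {f : X → ℝ} {c : ℝ} :
    (LipWrt dist f ∧ lipNorm dist f ≤ c) ↔
      (∀ x, |f x| ≤ c) ∧ ∀ x y z, |f x| * dist y z + |f y - f z| ≤ c * dist y z := by
  constructor
  · rintro ⟨hf, hc⟩
    have hbdd : BddAbove (range fun x => |f x|) :=
      (isCompact_range hf.continuous.abs).bddAbove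
    have hsup : ∀ x, |f x| ≤ ⨆ x, |f x| := fun x => le_ciSup hbdd x
    have hS : BddAbove {c | ∃ x y, x ≠ y ∧ c = |f x - f y| / dist x y} := by
      obtain ⟨K, hK⟩ := hf
      refine ⟨K, ?_⟩
      rintro _ ⟨x, y, hxy, rfl⟩
      exact (div_le_iff₀ (dist_pos.2 hxy)).2 (hK x y)
    have hS0 : 0 ≤ sSup {c | ∃ x y, x ≠ y ∧ c = |f x - f y| / dist x y} := by
      apply Real.sSup_nonneg
      rintro _ ⟨x, y, -, rfl⟩
      positivity
    unfold lipNorm at hc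
    refine ⟨fun x => by linarith [hsup x], fun x y z => ?_⟩
    rcases eq_or_ne y z with rfl | hyz
    · simp
    · have hpos := dist_pos.2 hyz
      have h1 := le_csSup hS ⟨y, z, hyz, rfl⟩
      have h2 : |f y - f z| / dist y z ≤ c - |f x| := by linarith [hsup x]
      rw [div_le_iff₀ hpos] at h2
      linarith
  · rintro ⟨hf, h⟩
    refine ⟨⟨c, fun y z => ?_⟩, ?_⟩
    · have := h y y z
      nlinarith [abs_nonneg (f y), dist_nonneg (x := y) (y := z),
        mul_nonneg (abs_nonneg (f y)) (dist_nonneg (x := y) (y := z))]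
    · unfold lipNorm
      rcases eq_empty_or_nonempty {c | ∃ x y : X, x ≠ y ∧ c = |f x - f y| / dist x y} with h0 | h0
      · rw [h0, Real.sSup_empty, add_zero]
        exact ciSup_le hf
      · rw [← le_sub_iff_add_le']
        refine csSup_le h0 ?_
        rintro _ ⟨y, z, hyz, rfl⟩
        rw [le_sub_comm]
        refine ciSup_le fun x => ?_
        have hpos := dist_pos.2 hyz
        rw [le_sub_comm, div_le_iff₀ hpos]
        linarith [h x y z]

lemma LipWrt.abs_le [Nonempty X] {f : X → ℝ} (hf : LipWrt dist f) (x : X) :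
    |f x| ≤ lipNorm dist f :=
  (lipNorm_le_iff.1 ⟨hf, le_rfl⟩).1 x

lemma LipWrt.bound [Nonempty X] {f : X → ℝ} (hf : LipWrt dist f) (x y z : X) :
    |f x| * dist y z + |f y - f z| ≤ lipNorm dist f * dist y z :=
  (lipNorm_le_iff.1 ⟨hf, le_rfl⟩).2 x y z

lemma lipWrt_add_and [Nonempty X] {f g : X → ℝ} (hf : LipWrt dist f) (hg : LipWrt dist g) :
    LipWrt dist (f + g) ∧ lipNorm dist (f + g) ≤ lipNorm dist f + lipNorm dist g := by
  refine lipNorm_le_iff.2 ⟨fun x => ?_, fun x y z => ?_⟩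
  · exact (abs_add_le _ _).trans (add_le_add (hf.abs_le x) (hg.abs_le x))
  · have h1 := mul_le_mul_of_nonneg_right (abs_add_le (f x) (g x)) (dist_nonneg (x := y) (y := z))
    have h2 : |(f + g) y - (f + g) z| ≤ |f y - f z| + |g y - g z| := by
      have := abs_add_le (f y - f z) (g y - g z)
      simpa [add_sub_add_comm] using this
    have h3 := hf.bound x y z
    have h4 := hg.bound x y z
    simp only [Pi.add_apply] at *
    nlinarith

lemma lipWrt_smul_and [Nonempty X] {f : X → ℝ} (a : ℝ) (hf : LipWrt dist f) :
    LipWrt dist (a • f) ∧ lipNorm dist (a • f) ≤ |a| * lipNorm dist f := by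
  refine lipNorm_le_iff.2 ⟨fun x => ?_, fun x y z => ?_⟩
  · rw [Pi.smul_apply, smul_eq_mul, abs_mul]
    exact mul_le_mul_of_nonneg_left (hf.abs_le x) (abs_nonneg a)
  · have h := mul_le_mul_of_nonneg_left (hf.bound x y z) (abs_nonneg a)
    simp only [Pi.smul_apply, smul_eq_mul, ← mul_sub, abs_mul]
    linarith

lemma lipWrt_zero_and [Nonempty X] :
    LipWrt dist (0 : X → ℝ) ∧ lipNorm dist (0 : X → ℝ) ≤ 0 :=
  lipNorm_le_iff.2 ⟨by simp, by simp⟩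

lemma LipWrt.lipNorm_nonneg [Nonempty X] {f : X → ℝ} (hf : LipWrt dist f) :
    0 ≤ lipNorm dist f :=
  (abs_nonneg _).trans (hf.abs_le (Classical.arbitrary X))

lemma LipWrt.neg_and [Nonempty X] {f : X → ℝ} (hf : LipWrt dist f) (hf1 : lipNorm dist f ≤ 1) :
    LipWrt dist (-f) ∧ lipNorm dist (-f) ≤ 1 := by
  have h := lipWrt_smul_and (-1) hf
  rw [neg_one_smul, abs_neg, abs_one, one_mul] at h
  exact ⟨h.1, h.2.trans hf1⟩

end LipNorm

/-- The submodule of Lipschitz functions. -/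
def lipSubmodule (X : Type*) [MetricSpace X] [CompactSpace X] [Nonempty X] :
    Submodule ℝ (X → ℝ) where
  carrier := {f | LipWrt dist f}
  add_mem' hf hg := (lipWrt_add_and hf hg).1
  zero_mem' := lipWrt_zero_and.1
  smul_mem' a _ hf := (lipWrt_smul_and a hf).1

/-- The space of Lipschitz functions, as a type to be normed by `lipNorm dist`. -/
def LipSpace (X : Type*) [MetricSpace X] [CompactSpace X] [Nonempty X] : Type _ :=
  lipSubmodule X

namespace LipSpace

variable {X : Type*} [MetricSpace X] [CompactSpace X] [Nonempty X]

noncomputable instance : AddCommGroup (LipSpace X) := inferInstanceAs (AddCommGroup (lipSubmodule X))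

noncomputable instance : Module ℝ (LipSpace X) := inferInstanceAs (Module ℝ (lipSubmodule X))

noncomputable instance : Norm (LipSpace X) := ⟨fun f => lipNorm dist f.1⟩

lemma core : SeminormedSpace.Core ℝ (LipSpace X) where
  norm_nonneg f := LipWrt.lipNorm_nonneg f.2
  norm_smul a f := by
    refine le_antisymm (lipWrt_smul_and a f.2).2 ?_
    rcases eq_or_ne a 0 with rfl | ha
    · rw [norm_zero, zero_mul]
      exact LipWrt.lipNorm_nonneg ((0 : ℝ) • f).2
    · have h := (lipWrt_smul_and a⁻¹ (a • f).2).2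
      have h1 : a⁻¹ • (a • f).1 = f.1 := inv_smul_smul₀ ha f.1
      rw [h1, abs_inv] at h
      rw [Real.norm_eq_abs]
      exact (le_inv_mul_iff₀ (abs_pos.2 ha)).1 h
  norm_triangle f g := (lipWrt_add_and f.2 g.2).2

noncomputable instance : SeminormedAddCommGroup (LipSpace X) := .ofCore core

noncomputable instance : NormedSpace ℝ (LipSpace X) where
  norm_smul_le a f := (core.norm_smul a f).le

end LipSpace

section KR

variable {X : Type*} [MetricSpace X] [CompactSpace X] [MeasurableSpace X]

lemma LipWrt.integrable [BorelSpace X] {f : X → ℝ} (hf : LipWrt dist f) (μ : ProbabilityMeasure X) :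
    Integrable f (μ : Measure X) :=
  hf.continuous.integrable_of_hasCompactSupport (HasCompactSupport.of_compactSpace f)

lemma LipWrt.continuous_integral [BorelSpace X] {f : X → ℝ} (hf : LipWrt dist f) :
    Continuous fun μ : ProbabilityMeasure X => ∫ x, f x ∂(μ : Measure X) :=
  ProbabilityMeasure.continuous_integral_continuousMap (⟨f, hf.continuous⟩ : C(X, ℝ))

variable [Nonempty X]

lemma LipWrt.abs_integral_le {f : X → ℝ} (hf : LipWrt dist f) (hf1 : lipNorm dist f ≤ 1)
    (μ : ProbabilityMeasure X) : |∫ x, f x ∂(μ : Measure X)| ≤ 1 := by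
  have := norm_integral_le_of_norm_le_const (μ := (μ : Measure X)) (f := f) (C := 1)
    (ae_of_all _ fun x => (hf.abs_le x).trans hf1)
  simpa using this

lemma integral_sub_le_KRdist {f : X → ℝ} (hf : LipWrt dist f) (hf1 : lipNorm dist f ≤ 1)
    (μ ν : ProbabilityMeasure X) :
    (∫ x, f x ∂(μ : Measure X)) - ∫ x, f x ∂(ν : Measure X) ≤ KRdist dist μ ν := by
  refine le_csSup ⟨2, ?_⟩ ⟨f, hf, hf1, rfl⟩
  rintro _ ⟨g, hg, hg1, rfl⟩
  have h1 := abs_le.1 (hg.abs_integral_le hg1 μ)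
  have h2 := abs_le.1 (hg.abs_integral_le hg1 ν)
  linarith [h1.2, h2.1]

lemma KRdist_le {μ ν : ProbabilityMeasure X} {c : ℝ}
    (h : ∀ f : X → ℝ, LipWrt dist f → lipNorm dist f ≤ 1 →
      (∫ x, f x ∂(μ : Measure X)) - ∫ x, f x ∂(ν : Measure X) ≤ c) : KRdist dist μ ν ≤ c := by
  refine csSup_le ⟨_, 0, lipWrt_zero_and.1, lipWrt_zero_and.2.trans zero_le_one, rfl⟩ ?_
  rintro _ ⟨f, hf, hf1, rfl⟩
  exact h f hf hf1

lemma KRdist_nonneg (μ ν : ProbabilityMeasure X) : 0 ≤ KRdist dist μ ν := by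
  simpa using integral_sub_le_KRdist lipWrt_zero_and.1
    (lipWrt_zero_and.2.trans zero_le_one) μ ν

lemma KRdist_triangle (μ ν ξ : ProbabilityMeasure X) :
    KRdist dist μ ξ ≤ KRdist dist μ ν + KRdist dist ν ξ :=
  KRdist_le fun f hf hf1 => by
    linarith [integral_sub_le_KRdist hf hf1 μ ν, integral_sub_le_KRdist hf hf1 ν ξ]

lemma KRdist_comm_le (μ ν : ProbabilityMeasure X) : KRdist dist μ ν ≤ KRdist dist ν μ :=
  KRdist_le fun f hf hf1 => by
    have hn := hf.neg_and hf1
    have h := integral_sub_le_KRdist hn.1 hn.2 ν μ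
    simp only [Pi.neg_apply, integral_neg] at h
    linarith

lemma KRdistSet_le {M : Set (ProbabilityMeasure X)} {ν : ProbabilityMeasure X} (hν : ν ∈ M)
    (μ : ProbabilityMeasure X) : KRdistSet dist μ M ≤ KRdist dist μ ν := by
  refine csInf_le ⟨0, ?_⟩ ⟨ν, hν, rfl⟩
  rintro _ ⟨ξ, -, rfl⟩
  exact KRdist_nonneg _ _

lemma KRdistSet_le_add {M : Set (ProbabilityMeasure X)} (hM : M.Nonempty)
    (μ ν : ProbabilityMeasure X) :
    KRdistSet dist μ M ≤ KRdist dist μ ν + KRdistSet dist ν M := by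
  rw [← sub_le_iff_le_add']
  obtain ⟨ξ₀, hξ₀⟩ := hM
  refine le_csInf ⟨_, ξ₀, hξ₀, rfl⟩ ?_
  rintro _ ⟨ξ, hξ, rfl⟩
  linarith [KRdistSet_le hξ μ, KRdist_triangle μ ν ξ]

open BoundedContinuousFunction in
/-- The unit ball for the Lipschitz norm, inside the space of continuous functions. -/
def lipUnitBall (X : Type*) [MetricSpace X] : Set (X →ᵇ ℝ) :=
  {f | LipWrt dist f ∧ lipNorm dist f ≤ 1}

omit [MeasurableSpace X] in
lemma isCompact_lipUnitBall : IsCompact (lipUnitBall X) := by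
  have hB : lipUnitBall X = {f | (∀ x, |f x| ≤ 1) ∧
      ∀ x y z, |f x| * dist y z + |f y - f z| ≤ 1 * dist y z} :=
    Set.ext fun f => lipNorm_le_iff
  have hev : ∀ x : X, Continuous fun f : BoundedContinuousFunction X ℝ => f x :=
    fun x => continuous_eval_const x
  refine BoundedContinuousFunction.arzela_ascoli₂ (Metric.closedBall 0 1)
    (isCompact_closedBall _ _) _ ?_ ?_ ?_
  · rw [hB]
    simp only [ofPred_and, ofPred_forall]
    refine IsClosed.inter (isClosed_iInter fun x => isClosed_le (hev x).abs continuous_const)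
      (isClosed_iInter fun x => isClosed_iInter fun y => isClosed_iInter fun z =>
        isClosed_le ?_ continuous_const)
    exact ((hev x).abs.mul continuous_const).add ((hev y).sub (hev z)).abs
  · intro f x hf
    rw [hB] at hf
    simpa using hf.1 x
  · refine (LipschitzWith.uniformEquicontinuous _ 1 fun f => ?_).equicontinuous
    refine LipschitzWith.of_dist_le_mul fun y z => ?_
    have h := (lipNorm_le_iff.1 f.2).2 y y z
    have h' := mul_nonneg (abs_nonneg (f.1 y)) (dist_nonneg (x := y) (y := z))
    rw [Real.dist_eq, NNReal.coe_one]
    exact le_trans (by linarith) h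

omit [MeasurableSpace X] in
lemma convex_lipUnitBall : Convex ℝ (lipUnitBall X) := by
  intro f hf g hg a b ha hb hab
  have h1 := lipWrt_smul_and a hf.1
  have h2 := lipWrt_smul_and b hg.1
  have h := lipWrt_add_and h1.1 h2.1
  refine ⟨h.1, h.2.trans ((add_le_add h1.2 h2.2).trans ?_)⟩
  rw [abs_of_nonneg ha, abs_of_nonneg hb]
  nlinarith [hf.2, hg.2]

variable [BorelSpace X]

omit [CompactSpace X] [Nonempty X] in
lemma abs_integral_sub_integral_le (f g : BoundedContinuousFunction X ℝ)
    (μ : ProbabilityMeasure X) :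
    |(∫ x, f x ∂(μ : Measure X)) - ∫ x, g x ∂(μ : Measure X)| ≤ dist f g := by
  rw [← integral_sub (f.integrable _) (g.integrable _)]
  have := norm_integral_le_of_norm_le_const (μ := (μ : Measure X)) (f := fun x => f x - g x)
    (C := dist f g) (ae_of_all _ fun x => (dist_eq_norm _ _).symm.trans_le (f.dist_coe_le_dist x))
  simpa using this

lemma eventually_KRdist_lt (μ : ProbabilityMeasure X) {ε : ℝ} (hε : 0 < ε) :
    ∀ᶠ ν in 𝓝 μ, KRdist dist ν μ < ε := by
  obtain ⟨t, -, ht, hcov⟩ := isCompact_lipUnitBall (X := X).finite_cover_balls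
    (show 0 < ε / 4 by linarith)
  have hev : ∀ g ∈ t, ∀ᶠ ν : ProbabilityMeasure X in 𝓝 μ,
      (∫ x, g x ∂(ν : Measure X)) - ∫ x, g x ∂(μ : Measure X) < ε / 4 := fun g _ => by
    have hc := (ProbabilityMeasure.continuous_integral_boundedContinuousFunction g).sub
      (continuous_const (y := ∫ x, g x ∂(μ : Measure X)))
    exact hc.continuousAt.eventually_lt continuousAt_const (by simp; linarith)
  filter_upwards [(eventually_all_finite ht).2 hev] with ν hν
  refine lt_of_le_of_lt (KRdist_le (c := 3 * (ε / 4)) fun f hf hf1 => ?_) (by linarith)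
  let f' : BoundedContinuousFunction X ℝ := .mkOfCompact ⟨f, hf.continuous⟩
  obtain ⟨g, hg, hfg⟩ := mem_iUnion₂.1 (hcov (show f' ∈ lipUnitBall X from ⟨hf, hf1⟩))
  rw [Metric.mem_ball] at hfg
  have h1 := abs_le.1 (abs_integral_sub_integral_le f' g ν)
  have h2 := abs_le.1 (abs_integral_sub_integral_le f' g μ)
  have h3 := hν g hg
  change (∫ x, f' x ∂(ν : Measure X)) - ∫ x, f' x ∂(μ : Measure X) ≤ _
  linarith [h1.2, h2.1]

lemma continuous_KRdistSet {M : Set (ProbabilityMeasure X)} (hM : M.Nonempty) :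
    Continuous fun μ : ProbabilityMeasure X => KRdistSet dist μ M := by
  rw [continuous_iff_continuousAt]
  intro μ
  rw [Metric.continuousAt_iff']
  intro ε hε
  filter_upwards [eventually_KRdist_lt μ hε] with ν hν
  rw [Real.dist_eq, abs_lt]
  constructor
  · linarith [KRdistSet_le_add hM μ ν, KRdist_comm_le μ ν]
  · linarith [KRdistSet_le_add hM ν μ]

omit [CompactSpace X] [Nonempty X] in
lemma ConvexPM.convex_image_integral {M : Set (ProbabilityMeasure X)} (hM : ConvexPM M) :
    Convex ℝ ((fun (ν : ProbabilityMeasure X) (f : BoundedContinuousFunction X ℝ) =>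
      ∫ x, f x ∂(ν : Measure X)) '' M) := by
  rintro _ ⟨μ, hμ, rfl⟩ _ ⟨ν, hν, rfl⟩ a b ha hb hab
  lift a to ℝ≥0 using ha
  lift b to ℝ≥0 using hb
  have hab' : a + b = 1 := by exact_mod_cast hab
  have hb' : b = 1 - a := by rw [← hab', add_tsub_cancel_left]
  have hprob : IsProbabilityMeasure (a • (μ : Measure X) + b • (ν : Measure X)) := by
    constructor
    rw [Measure.add_apply, Measure.smul_apply, Measure.smul_apply, measure_univ, measure_univ,
      ← add_smul, hab', one_smul]
  refine ⟨⟨_, hprob⟩, hM μ hμ ν hν a (hab' ▸ le_self_add) _ (by rw [← hb']; rfl), ?_⟩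
  ext f
  have h1 : Integrable f (a • (μ : Measure X)) := (f.integrable _).smul_measure_nnreal
  have h2 : Integrable f (b • (ν : Measure X)) := (f.integrable _).smul_measure_nnreal
  change ∫ x, f x ∂(a • (μ : Measure X) + b • (ν : Measure X)) = _
  rw [integral_add_measure h1 h2, integral_smul_nnreal_measure, integral_smul_nnreal_measure]
  rfl

/-- By the minimax theorem, some Lipschitz function of norm at most one almost separates `μ`
from the convex set `M` by the Kantorovich-Rubinstein distance. -/
lemma exists_separating_lip {M : Set (ProbabilityMeasure X)} (hconv : ConvexPM M)
    (μ : ProbabilityMeasure X) {r : ℝ} (hr : r < KRdistSet dist μ M) :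
    ∃ f : X → ℝ, LipWrt dist f ∧ lipNorm dist f ≤ 1 ∧
      ∀ ν ∈ M, r ≤ (∫ x, f x ∂(ν : Measure X)) - ∫ x, f x ∂(μ : Measure X) := by
  by_contra! hcon
  let E : ProbabilityMeasure X → BoundedContinuousFunction X ℝ → ℝ :=
    fun ν f => ∫ x, f x ∂(ν : Measure X)
  have hE : ∀ ν, Continuous (E ν) := fun ν =>
    (LipschitzWith.of_dist_le_mul (K := 1) fun f g => by
      rw [NNReal.coe_one, one_mul]
      exact abs_integral_sub_integral_le f g ν).continuous
  have hElin : ∀ ν, IsLinearMap ℝ (E ν) := fun ν =>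
    ⟨fun f g => integral_add (f.integrable _) (g.integrable _),
      fun c f => integral_smul c _⟩
  let φ : BoundedContinuousFunction X ℝ → (BoundedContinuousFunction X ℝ → ℝ) → ℝ :=
    fun f y => E μ f - y f
  obtain ⟨s, hsM, hs, hcov⟩ := isCompact_lipUnitBall (X := X).elim_finite_subcover_image
    (b := M) (c := fun ν => {f | -r < φ f (E ν)})
    (fun ν _ => isOpen_lt continuous_const ((hE μ).sub (hE ν)))
    (fun f hf => by
      obtain ⟨ν, hν, h⟩ := hcon f hf.1 hf.2
      refine mem_iUnion₂.2 ⟨ν, hν, ?_⟩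
      change -r < (∫ x, f x ∂(μ : Measure X)) - ∫ x, f x ∂(ν : Measure X)
      linarith)
  obtain ⟨_, ⟨ν, hν, rfl⟩, h⟩ := Sion.exists_lt_iInf_of_lt_iInf_of_finite (f := φ)
    (X := lipUnitBall X) (Y := E '' M) (t := -r) (s := E '' s)
    ⟨0, lipWrt_zero_and.1, lipWrt_zero_and.2.trans zero_le_one⟩ isCompact_lipUnitBall
    (by
      rintro _ ⟨ν, -, rfl⟩
      exact ((hE μ).sub (hE ν)).continuousOn.lowerSemicontinuousOn)
    (by
      rintro _ ⟨ν, -, rfl⟩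
      refine ConvexOn.quasiconvexOn ⟨convex_lipUnitBall, fun f _ g _ a b _ _ _ => le_of_eq ?_⟩
      have hlin : ∀ ξ, E ξ (a • f + b • g) = a * E ξ f + b * E ξ g := fun ξ => by
        rw [(hElin ξ).map_add, (hElin ξ).map_smul, (hElin ξ).map_smul, smul_eq_mul, smul_eq_mul]
      change E μ (a • f + b • g) - E ν (a • f + b • g) = a * (E μ f - E ν f) + b * (E μ g - E ν g)
      rw [hlin, hlin]
      ring)
    hconv.convex_image_integral
    (fun f _ => (continuous_const.sub (continuous_apply f)).continuousOn.upperSemicontinuousOn)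
    (fun f _ => by
      refine ConcaveOn.quasiconcaveOn ⟨hconv.convex_image_integral,
        fun y _ z _ a b _ _ hab => le_of_eq ?_⟩
      simp only [φ, Pi.add_apply, Pi.smul_apply, smul_eq_mul]
      linear_combination (E μ f) * hab)
    convex_lipUnitBall (hs.image E) (image_mono hsM)
    (fun f hf => by
      obtain ⟨ν, hν, h⟩ := mem_iUnion₂.1 (hcov hf)
      exact ⟨E ν, mem_image_of_mem E hν, h⟩)
  have hle : KRdist dist ν μ ≤ r := KRdist_le fun f hf hf1 => by
    have := h (.mkOfCompact ⟨f, hf.continuous⟩) ⟨hf, hf1⟩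
    change -r < (∫ x, f x ∂(μ : Measure X)) - ∫ x, f x ∂(ν : Measure X) at this
    linarith
  linarith [KRdistSet_le hν μ, KRdist_comm_le μ ν]

/-- The admissible bets at `μ`: those of norm less than `r_μ - r₀` whose expectation under every
measure in `M` exceeds the one under `μ` by a uniform margin larger than `(r_μ - r₀) r_μ / 2`. -/
def admissibleBets (M : Set (ProbabilityMeasure X)) (r₀ : ℝ) (μ : ProbabilityMeasure X) :
    Set (LipSpace X) :=
  {f | ‖f‖ < KRdistSet dist μ M - r₀ ∧ ∃ q : ℝ,
    (1/2) * (KRdistSet dist μ M - r₀) * KRdistSet dist μ M < q - ∫ x, f.1 x ∂(μ : Measure X) ∧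
    ∀ ν ∈ M, q ≤ ∫ x, f.1 x ∂(ν : Measure X)}

lemma LipSpace.integral_combo (f g : LipSpace X) (a b : ℝ) (μ : ProbabilityMeasure X) :
    ∫ x, (a • f + b • g).1 x ∂(μ : Measure X) =
      a * (∫ x, f.1 x ∂(μ : Measure X)) + b * ∫ x, g.1 x ∂(μ : Measure X) := by
  rw [← integral_const_mul, ← integral_const_mul]
  exact integral_add ((LipWrt.integrable f.2 μ).const_mul a) ((LipWrt.integrable g.2 μ).const_mul b)

lemma convex_admissibleBets (M : Set (ProbabilityMeasure X)) (r₀ : ℝ)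
    (μ : ProbabilityMeasure X) : Convex ℝ (admissibleBets M r₀ μ) := by
  rintro f ⟨hf, p, hp, hpM⟩ g ⟨hg, q, hq, hqM⟩ a b ha hb hab
  refine ⟨?_, a * p + b * q, ?_, fun ν hν => ?_⟩
  · have := convex_ball (0 : LipSpace X) (KRdistSet dist μ M - r₀)
      (mem_ball_zero_iff.2 hf) (mem_ball_zero_iff.2 hg) ha hb hab
    exact mem_ball_zero_iff.1 this
  · rw [LipSpace.integral_combo]
    have := (convex_Ioi ((1/2) * (KRdistSet dist μ M - r₀) * KRdistSet dist μ M)) hp hq ha hb hab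
    simp only [smul_eq_mul, mem_Ioi] at this
    linarith
  · rw [LipSpace.integral_combo]
    exact add_le_add (mul_le_mul_of_nonneg_left (hpM ν hν) ha)
      (mul_le_mul_of_nonneg_left (hqM ν hν) hb)

lemma admissibleBets_nonempty {M : Set (ProbabilityMeasure X)} (hconv : ConvexPM M) {r₀ : ℝ} (hr₀ : 0 < r₀) {μ : ProbabilityMeasure X}
    (hμ : r₀ < KRdistSet dist μ M) : (admissibleBets M r₀ μ).Nonempty := by
  set r := KRdistSet dist μ M with hr
  obtain ⟨f, hf, hf1, h⟩ := exists_separating_lip hconv μ (r := 3 / 4 * r) (by linarith)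
  have hs : 0 < r - r₀ := sub_pos.2 hμ
  have hc : 0 < 3 / 4 * (r - r₀) := by positivity
  have hcf := lipWrt_smul_and (3 / 4 * (r - r₀)) hf
  have hint : ∀ ν : ProbabilityMeasure X, ∫ x, ((3 / 4 * (r - r₀)) • f) x ∂(ν : Measure X) =
      3 / 4 * (r - r₀) * ∫ x, f x ∂(ν : Measure X) := fun ν => integral_const_mul _ _
  refine ⟨⟨_, hcf.1⟩, ?_, 3 / 4 * (r - r₀) * (3 / 4 * r + ∫ x, f x ∂(μ : Measure X)), ?_, ?_⟩
  · refine lt_of_le_of_lt hcf.2 ?_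
    rw [abs_of_pos hc]
    nlinarith
  · rw [hint]
    nlinarith [mul_pos hs (hr₀.trans hμ)]
  · intro ν hν
    rw [hint]
    exact mul_le_mul_of_nonneg_left (by linarith [h ν hν]) hc.le

lemma eventually_mem_admissibleBets {M : Set (ProbabilityMeasure X)} (hne : M.Nonempty)
    {r₀ : ℝ} {μ : ProbabilityMeasure X} {f : LipSpace X} (hf : f ∈ admissibleBets M r₀ μ) :
    ∀ᶠ ν in 𝓝 μ, f ∈ admissibleBets M r₀ ν := by
  obtain ⟨hf, q, hq, hqM⟩ := hf
  have hr := continuous_KRdistSet hne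
  have h1 := continuousAt_const.eventually_lt (hr.sub continuous_const).continuousAt hf
  have h2 := ((continuous_const.mul (hr.sub continuous_const)).mul hr).continuousAt.eventually_lt
    (continuous_const.sub (LipWrt.continuous_integral f.2)).continuousAt hq
  filter_upwards [h1, h2] with ν h1 h2
  exact ⟨h1, q, h2, hqM⟩

end KR

/-- Lemma 5.3 of the paper: on `U := {μ | D^ρ(μ, M) > r₀}` there is a
continuous (with respect to `‖·‖_ρ`) selection `β'` of Lipschitz functions with
`‖β'(μ)‖_ρ < r_μ − r₀` and `inf_{ν ∈ M} E_ν[β'(μ)] − E_μ[β'(μ)] > ½(r_μ − r₀)·r_μ`. -/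
theorem statement14 {X : Type*} [MetricSpace X] [CompactSpace X]
    [MeasurableSpace X] [BorelSpace X]
    (M : Set (ProbabilityMeasure X)) (hne : M.Nonempty) (hconv : ConvexPM M)
    (r₀ : ℝ) (hr₀ : 0 < r₀) :
    ∃ β' : {μ : ProbabilityMeasure X // r₀ < KRdistSet dist μ M} → X → ℝ,
      (∀ μ, LipWrt dist (β' μ)) ∧
      (∀ μ, ∀ ε > 0, ∀ᶠ ν in nhds μ, lipNorm dist (fun x => β' ν x - β' μ x) < ε) ∧
      (∀ μ, lipNorm dist (β' μ) < KRdistSet dist μ.1 M - r₀) ∧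
      (∀ μ, (1/2) * (KRdistSet dist μ.1 M - r₀) * KRdistSet dist μ.1 M <
        sInf {c : ℝ | ∃ ν ∈ M, c = ∫ x, β' μ x ∂(ν : Measure X)} -
          ∫ x, β' μ x ∂(μ.1 : Measure X)) := by
  obtain ⟨μ₀, hμ₀⟩ := hne
  have hX : Nonempty X := μ₀.nonempty
  have hne : M.Nonempty := ⟨μ₀, hμ₀⟩
  have : TopologicalSpace.MetrizableSpace {μ : ProbabilityMeasure X // r₀ < KRdistSet dist μ M} :=
    IsEmbedding.subtypeVal.metrizableSpace
  let : MetricSpace {μ : ProbabilityMeasure X // r₀ < KRdistSet dist μ M} :=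
    TopologicalSpace.metrizableSpaceMetric _
  obtain ⟨g, hg⟩ := exists_continuous_forall_mem_convex_of_local_const
    (X := {μ : ProbabilityMeasure X // r₀ < KRdistSet dist μ M})
    (t := fun μ => admissibleBets M r₀ μ.1)
    (fun μ => convex_admissibleBets M r₀ μ.1)
    (fun μ => by
      obtain ⟨f, hf⟩ := admissibleBets_nonempty hconv hr₀ μ.2
      exact ⟨f, continuous_subtype_val.continuousAt.eventually
        (eventually_mem_admissibleBets hne hf)⟩)
  refine ⟨fun μ => (g μ).1, fun μ => (g μ).2, fun μ ε hε => ?_, fun μ => (hg μ).1, fun μ => ?_⟩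
  · filter_upwards [g.continuous.continuousAt.eventually (Metric.ball_mem_nhds (g μ) hε)] with ν hν
    exact mem_ball_iff_norm.1 hν
  · obtain ⟨-, q, hq, hqM⟩ := hg μ
    refine hq.trans_le (sub_le_sub_right ?_ _)
    refine le_csInf ⟨_, μ₀, hμ₀, rfl⟩ ?_
    rintro _ ⟨ν, hν, rfl⟩
    exact hqM ν hν
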